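/- Let p > 0, K ⊆ ℝ⁺ a p-convex set, h : (0,∞) → ℝ a nonnegative super-multiplicative function, f an operator (p,h)-convex function on K, wᵢ > 0 (i = 1,…,k) weights, Aᵢ positive semidefinite matrices with spectra in K, and M_k = {1,…,k}. Then F(M_k) ≤ min over all pairs 1 ≤ i < j ≤ k of the quantity h(wᵢ + w_j)·f([(wᵢ Aᵢ^p + w_j A_j^p)/(wᵢ + w_j)]^{1/p}) − h(wᵢ) f(Aᵢ) − h(w_j) f(A_j), where F(S) = h(W_S)·f([W_S⁻¹ Σ_{i∈S} wᵢ Aᵢ^p]^{1/p}) − Σ_{i∈S} h(wᵢ) f(Aᵢ) and W_S = Σ_{i∈S} wᵢ. (The minimum is in the Loewner order, i.e. F(M_k) is ≤ each such matrix.) -/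

import Mathlib

open Matrix
open scoped ComplexOrder

/-- The matrix `A` raised to the real power `p`, defined via the continuous
functional calculus (using the real power function `Real.rpow`). -/
noncomputable def mpow {n : ℕ} (A : Matrix (Fin n) (Fin n) ℂ) (p : ℝ) :
    Matrix (Fin n) (Fin n) ℂ :=
  cfc (fun x : ℝ => x ^ p) A

/-- The Loewner order on matrices: `loewnerLE X Y` iff `Y - X` is positive semidefinite. -/
def loewnerLE {n : ℕ} (X Y : Matrix (Fin n) (Fin n) ℂ) : Prop :=
  (Y - X).PosSemidef

/-- A set `K ⊆ ℝ` is `p`-convex if `(l*x^p + (1-l)*y^p)^(1/p) ∈ K` for all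
`x, y ∈ K` and `l ∈ [0,1]`. -/
def PConvex (p : ℝ) (K : Set ℝ) : Prop :=
  ∀ x ∈ K, ∀ y ∈ K, ∀ l ∈ Set.Icc (0 : ℝ) 1,
    (l * x ^ p + (1 - l) * y ^ p) ^ (1 / p) ∈ K

/-- `h` is super-multiplicative on `J`: `h (x*y) ≥ h x * h y` for all `x, y ∈ J`. -/
def SuperMultiplicativeOn (J : Set ℝ) (h : ℝ → ℝ) : Prop :=
  ∀ x ∈ J, ∀ y ∈ J, h x * h y ≤ h (x * y)

/-- `f` is operator `(p,h)`-convex on `K`: `f` is nonnegative and continuous on `K`, and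
`f([α A^p + (1-α) B^p]^{1/p}) ≤ h(α) f(A) + h(1-α) f(B)` (in the Loewner order) for all
positive semidefinite matrices `A, B` (of any order `n`) with spectra in `K` and all
`α ∈ (0,1)`, where matrix functions are taken via the continuous functional calculus. -/
def OperatorPHConvexOn (p : ℝ) (K : Set ℝ) (h : ℝ → ℝ) (f : ℝ → ℝ) : Prop :=
  (∀ x ∈ K, 0 ≤ f x) ∧ ContinuousOn f K ∧
  ∀ (n : ℕ) (A B : Matrix (Fin n) (Fin n) ℂ),
    A.PosSemidef → B.PosSemidef → spectrum ℝ A ⊆ K → spectrum ℝ B ⊆ K →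
    ∀ α ∈ Set.Ioo (0 : ℝ) 1,
      loewnerLE (cfc f (mpow (α • mpow A p + (1 - α) • mpow B p) (1 / p)))
        (h α • cfc f A + h (1 - α) • cfc f B)

/-- The index set function
`F(S) = h(W_S) • f([W_S⁻¹ ∑_{i ∈ S} wᵢ Aᵢ^p]^{1/p}) − ∑_{i ∈ S} h(wᵢ) • f(Aᵢ)`,
where `W_S = ∑_{i ∈ S} wᵢ`. -/
noncomputable def idxF (p : ℝ) (h f : ℝ → ℝ) {n : ℕ} (w : ℕ → ℝ)
    (A : ℕ → Matrix (Fin n) (Fin n) ℂ) (S : Finset ℕ) : Matrix (Fin n) (Fin n) ℂ :=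
  h (∑ i ∈ S, w i) •
      cfc f (mpow ((∑ i ∈ S, w i)⁻¹ • ∑ i ∈ S, w i • mpow (A i) p) (1 / p))
    - ∑ i ∈ S, h (w i) • cfc f (A i)

open scoped MatrixOrder in
lemma loewnerLE_iff_le {n : ℕ} {X Y : Matrix (Fin n) (Fin n) ℂ} : loewnerLE X Y ↔ X ≤ Y :=
  Iff.rfl

/-- If `K ⊆ [0, ∞)` is `p`-convex, then `{x ^ p | x ∈ K}` is convex. -/
lemma PConvex.convex_image_rpow {p : ℝ} (hp : 0 < p) {K : Set ℝ} (hK : K ⊆ Set.Ici 0)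
    (hKp : PConvex p K) : Convex ℝ ((fun x : ℝ => x ^ p) '' K) := by
  rintro _ ⟨x, hx, rfl⟩ _ ⟨y, hy, rfl⟩ a b ha hb hab
  obtain rfl : b = 1 - a := by linarith
  refine ⟨_, hKp x hx y hy a ⟨ha, by linarith⟩, ?_⟩
  have h0 : 0 ≤ a * x ^ p + (1 - a) * y ^ p :=
    add_nonneg (mul_nonneg ha (Real.rpow_nonneg (hK hx) p))
      (mul_nonneg hb (Real.rpow_nonneg (hK hy) p))
  simp only [one_div, smul_eq_mul]
  exact Real.rpow_inv_rpow h0 hp.ne'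

open scoped MatrixOrder in
/-- A convex combination of Hermitian matrices with spectra in a convex set `C` has spectrum
in `C`. -/
lemma spectrum_convex_comb_subset {n : ℕ} {C : Set ℝ} (hC : Convex ℝ C)
    {X Y : Matrix (Fin n) (Fin n) ℂ} (hX : IsSelfAdjoint X) (hY : IsSelfAdjoint Y)
    (hXC : spectrum ℝ X ⊆ C) (hYC : spectrum ℝ Y ⊆ C) {a b : ℝ} (ha : 0 ≤ a) (hb : 0 ≤ b)
    (hab : a + b = 1) : spectrum ℝ (a • X + b • Y) ⊆ C := by
  rcases isEmpty_or_nonempty (Fin n) with hn | hn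
  · rw [spectrum.of_subsingleton]
    exact Set.empty_subset C
  have hfin : (spectrum ℝ X ∪ spectrum ℝ Y).Finite :=
    X.finite_real_spectrum.union Y.finite_real_spectrum
  have hne : (spectrum ℝ X ∪ spectrum ℝ Y).Nonempty :=
    (ContinuousFunctionalCalculus.spectrum_nonempty X hX).inl
  obtain ⟨l, hl, hlmin⟩ := Set.exists_min_image _ id hfin hne
  obtain ⟨u, hu, humax⟩ := Set.exists_max_image _ id hfin hne
  have hsub : spectrum ℝ X ∪ spectrum ℝ Y ⊆ C := Set.union_subset hXC hYC
  have hZ : IsSelfAdjoint (a • X + b • Y) :=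
    ((IsSelfAdjoint.all a).smul hX).add ((IsSelfAdjoint.all b).smul hY)
  have hcomb (r : ℝ) : algebraMap ℝ (Matrix (Fin n) (Fin n) ℂ) r =
      a • algebraMap ℝ (Matrix (Fin n) (Fin n) ℂ) r +
        b • algebraMap ℝ (Matrix (Fin n) (Fin n) ℂ) r := by
    rw [← add_smul, hab, one_smul]
  have hlow : algebraMap ℝ _ l ≤ a • X + b • Y := by
    rw [hcomb l]
    exact add_le_add
      (smul_le_smul_of_nonneg_left
        (algebraMap_le_of_le_spectrum fun x hx => hlmin x (Or.inl hx)) ha)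
      (smul_le_smul_of_nonneg_left
        (algebraMap_le_of_le_spectrum fun x hx => hlmin x (Or.inr hx)) hb)
  have hupp : a • X + b • Y ≤ algebraMap ℝ _ u := by
    rw [hcomb u]
    exact add_le_add
      (smul_le_smul_of_nonneg_left
        (le_algebraMap_of_spectrum_le fun x hx => humax x (Or.inl hx)) ha)
      (smul_le_smul_of_nonneg_left
        (le_algebraMap_of_spectrum_le fun x hx => humax x (Or.inr hx)) hb)
  rw [algebraMap_le_iff_le_spectrum] at hlow
  rw [le_algebraMap_iff_spectrum_le] at hupp
  exact fun x hx => hC.ordConnected.out (hsub hl) (hsub hu) ⟨hlow x hx, hupp x hx⟩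

lemma isSelfAdjoint_mpow {n : ℕ} (A : Matrix (Fin n) (Fin n) ℂ) (p : ℝ) :
    IsSelfAdjoint (mpow A p) :=
  cfc_predicate _ A

lemma spectrum_mpow {n : ℕ} {A : Matrix (Fin n) (Fin n) ℂ} (hA : IsSelfAdjoint A) (p : ℝ) :
    spectrum ℝ (mpow A p) = (fun x : ℝ => x ^ p) '' spectrum ℝ A :=
  cfc_map_spectrum _ A hA (A.finite_real_spectrum.continuousOn _)

/-- `(X ^ (1 / p)) ^ p = X` for a Hermitian `X` with nonnegative spectrum. -/
lemma mpow_one_div_mpow {n : ℕ} {X : Matrix (Fin n) (Fin n) ℂ} (hX : IsSelfAdjoint X)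
    (hX0 : spectrum ℝ X ⊆ Set.Ici 0) {p : ℝ} (hp : p ≠ 0) : mpow (mpow X (1 / p)) p = X := by
  unfold mpow
  rw [← cfc_comp' _ _ X ((X.finite_real_spectrum.image _).continuousOn _)
    (X.finite_real_spectrum.continuousOn _) hX]
  conv_rhs => rw [← cfc_id' ℝ X hX]
  refine cfc_congr fun x hx => ?_
  simp only [one_div]
  exact Real.rpow_inv_rpow (hX0 hx) hp

/-- The weighted mean of the `p`-th powers of the `A i`, `i ∈ S`. -/
noncomputable def powMean (p : ℝ) {n : ℕ} (w : ℕ → ℝ) (A : ℕ → Matrix (Fin n) (Fin n) ℂ)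
    (S : Finset ℕ) : Matrix (Fin n) (Fin n) ℂ :=
  (∑ i ∈ S, w i)⁻¹ • ∑ i ∈ S, w i • mpow (A i) p

lemma powMean_insert (p : ℝ) {n : ℕ} (w : ℕ → ℝ) (A : ℕ → Matrix (Fin n) (Fin n) ℂ)
    {S : Finset ℕ} {l : ℕ} (hl : l ∉ S) (hS : 0 < ∑ i ∈ S, w i) (hwl : 0 < w l) :
    powMean p w A (insert l S) =
      ((∑ i ∈ S, w i) / (∑ i ∈ S, w i + w l)) • powMean p w A S +
        (1 - (∑ i ∈ S, w i) / (∑ i ∈ S, w i + w l)) • mpow (A l) p := by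
  have h1 : 1 - (∑ i ∈ S, w i) / (∑ i ∈ S, w i + w l) = (∑ i ∈ S, w i + w l)⁻¹ * w l := by
    field_simp
    ring
  have h2 : (∑ i ∈ S, w i) / (∑ i ∈ S, w i + w l) * (∑ i ∈ S, w i)⁻¹ =
      (∑ i ∈ S, w i + w l)⁻¹ := by
    field_simp
  rw [powMean, powMean, Finset.sum_insert hl, Finset.sum_insert hl, add_comm (w l),
    h1, smul_smul, h2, mul_smul, smul_add, add_comm]

lemma isSelfAdjoint_powMean (p : ℝ) {n : ℕ} (w : ℕ → ℝ) (A : ℕ → Matrix (Fin n) (Fin n) ℂ)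
    (S : Finset ℕ) : IsSelfAdjoint (powMean p w A S) :=
  (IsSelfAdjoint.all _).smul <| isSelfAdjoint_sum S fun i _ =>
    (IsSelfAdjoint.all (w i)).smul (isSelfAdjoint_mpow (A i) p)

lemma spectrum_powMean_subset {p : ℝ} (hp : 0 < p) {K : Set ℝ} (hK : K ⊆ Set.Ici 0)
    (hKp : PConvex p K) {n : ℕ} {w : ℕ → ℝ} {A : ℕ → Matrix (Fin n) (Fin n) ℂ}
    {S : Finset ℕ} (hS : S.Nonempty) (hw : ∀ i ∈ S, 0 < w i)
    (hA : ∀ i ∈ S, IsSelfAdjoint (A i)) (hsA : ∀ i ∈ S, spectrum ℝ (A i) ⊆ K) :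
    spectrum ℝ (powMean p w A S) ⊆ (fun x : ℝ => x ^ p) '' K := by
  induction hS using Finset.Nonempty.cons_induction with
  | singleton a =>
    have ha := hw a (Finset.mem_singleton_self a)
    rw [powMean, Finset.sum_singleton, Finset.sum_singleton, smul_smul,
      inv_mul_cancel₀ ha.ne', one_smul, spectrum_mpow (hA a (Finset.mem_singleton_self a))]
    exact Set.image_mono (hsA a (Finset.mem_singleton_self a))
  | cons a S ha hS ih =>
    simp only [Finset.cons_eq_insert, Finset.forall_mem_insert] at hw hA hsA ⊢
    have hWS : 0 < ∑ i ∈ S, w i := Finset.sum_pos hw.2 hS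
    rw [powMean_insert p w A ha hWS hw.1]
    refine spectrum_convex_comb_subset (hKp.convex_image_rpow hp hK)
      (isSelfAdjoint_powMean p w A S) (isSelfAdjoint_mpow _ p) (ih hw.2 hA.2 hsA.2) ?_
      (by have := hw.1; positivity) ?_ (by ring)
    · rw [spectrum_mpow hA.1]
      exact Set.image_mono hsA.1
    · rw [sub_nonneg, div_le_one (add_pos hWS hw.1)]
      linarith [hw.1]

open scoped MatrixOrder in
/-- Adding one index to a nonempty index set decreases `idxF`. -/
lemma idxF_insert_le {p : ℝ} (hp : 0 < p) {K : Set ℝ} (hK : K ⊆ Set.Ici 0)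
    (hKp : PConvex p K) {h : ℝ → ℝ} (hh0 : ∀ x : ℝ, 0 < x → 0 ≤ h x)
    (hsm : ∀ x y : ℝ, 0 < x → 0 < y → h x * h y ≤ h (x * y))
    {f : ℝ → ℝ} (hf : OperatorPHConvexOn p K h f) {n : ℕ} {w : ℕ → ℝ}
    {A : ℕ → Matrix (Fin n) (Fin n) ℂ} {S : Finset ℕ} (hS : S.Nonempty) {l : ℕ} (hl : l ∉ S)
    (hw : ∀ i ∈ insert l S, 0 < w i) (hA : ∀ i ∈ insert l S, (A i).PosSemidef)
    (hsA : ∀ i ∈ insert l S, spectrum ℝ (A i) ⊆ K) :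
    idxF p h f w A (insert l S) ≤ idxF p h f w A S := by
  simp only [Finset.forall_mem_insert] at hw hA hsA
  have hWS : 0 < ∑ i ∈ S, w i := Finset.sum_pos hw.2 hS
  have hW : 0 < ∑ i ∈ S, w i + w l := add_pos hWS hw.1
  have hXsa := isSelfAdjoint_powMean p w A S
  have hXK : spectrum ℝ (powMean p w A S) ⊆ (fun x : ℝ => x ^ p) '' K :=
    spectrum_powMean_subset hp hK hKp hS hw.2 (fun i hi => (hA.2 i hi).isHermitian) hsA.2
  have hX0 : spectrum ℝ (powMean p w A S) ⊆ Set.Ici 0 := by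
    rintro _ hx
    obtain ⟨y, hy, rfl⟩ := hXK hx
    exact Real.rpow_nonneg (hK hy) p
  have hBK : spectrum ℝ (mpow (powMean p w A S) (1 / p)) ⊆ K := by
    rw [spectrum_mpow hXsa]
    rintro _ ⟨_, hx, rfl⟩
    obtain ⟨y, hy, rfl⟩ := hXK hx
    simpa only [one_div, Real.rpow_rpow_inv (hK hy) hp.ne'] using hy
  have hB : (mpow (powMean p w A S) (1 / p)).PosSemidef :=
    nonneg_iff_posSemidef.1 (cfc_nonneg fun x hx => Real.rpow_nonneg (hX0 hx) _)
  have hα : (∑ i ∈ S, w i) / (∑ i ∈ S, w i + w l) ∈ Set.Ioo (0 : ℝ) 1 :=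
    ⟨by positivity, by rw [div_lt_one hW]; linarith [hw.1]⟩
  have hconv := loewnerLE_iff_le.1 (hf.2.2 n _ (A l) hB hA.1 hBK hsA.1 _ hα)
  rw [mpow_one_div_mpow hXsa hX0 hp.ne', ← powMean_insert p w A hl hWS hw.1] at hconv
  have hsm₁ : h (∑ i ∈ S, w i + w l) * h ((∑ i ∈ S, w i) / (∑ i ∈ S, w i + w l)) ≤
      h (∑ i ∈ S, w i) :=
    (hsm _ _ hW hα.1).trans_eq (by rw [mul_div_cancel₀ _ hW.ne'])
  have hsm₂ : h (∑ i ∈ S, w i + w l) * h (1 - (∑ i ∈ S, w i) / (∑ i ∈ S, w i + w l)) ≤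
      h (w l) :=
    (hsm _ _ hW (sub_pos.2 hα.2)).trans_eq (by congr 1; field_simp; ring)
  have hfB : 0 ≤ cfc f (mpow (powMean p w A S) (1 / p)) :=
    cfc_nonneg fun x hx => hf.1 x (hBK hx)
  have hfA : 0 ≤ cfc f (A l) := cfc_nonneg fun x hx => hf.1 x (hsA.1 hx)
  have key : h (∑ i ∈ S, w i + w l) • cfc f (mpow (powMean p w A (insert l S)) (1 / p)) ≤
      h (∑ i ∈ S, w i) • cfc f (mpow (powMean p w A S) (1 / p)) + h (w l) • cfc f (A l) := by
    refine (smul_le_smul_of_nonneg_left hconv (hh0 _ hW)).trans ?_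
    rw [smul_add, smul_smul, smul_smul]
    exact add_le_add (smul_le_smul_of_nonneg_right hsm₁ hfB)
      (smul_le_smul_of_nonneg_right hsm₂ hfA)
  have hrw (T : Finset ℕ) : idxF p h f w A T =
      h (∑ i ∈ T, w i) • cfc f (mpow (powMean p w A T) (1 / p)) -
        ∑ i ∈ T, h (w i) • cfc f (A i) := rfl
  rw [hrw, hrw, Finset.sum_insert hl, Finset.sum_insert hl, add_comm (w l),
    ← sub_sub, sub_le_sub_iff_right, sub_le_iff_le_add]
  exact key

open scoped MatrixOrder in
/-- `idxF` is antitone on nonempty index sets. -/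
lemma loewnerLE_idxF_of_subset {p : ℝ} (hp : 0 < p) {K : Set ℝ} (hK : K ⊆ Set.Ici 0)
    (hKp : PConvex p K) {h : ℝ → ℝ} (hh0 : ∀ x : ℝ, 0 < x → 0 ≤ h x)
    (hsm : ∀ x y : ℝ, 0 < x → 0 < y → h x * h y ≤ h (x * y))
    {f : ℝ → ℝ} (hf : OperatorPHConvexOn p K h f) {n : ℕ} {w : ℕ → ℝ}
    {A : ℕ → Matrix (Fin n) (Fin n) ℂ} {S T : Finset ℕ} (hS : S.Nonempty) (hST : S ⊆ T)
    (hw : ∀ i ∈ T, 0 < w i) (hA : ∀ i ∈ T, (A i).PosSemidef)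
    (hsA : ∀ i ∈ T, spectrum ℝ (A i) ⊆ K) :
    loewnerLE (idxF p h f w A T) (idxF p h f w A S) := by
  rw [loewnerLE_iff_le]
  suffices h_union : ∀ R : Finset ℕ, Disjoint R S → R ⊆ T →
      idxF p h f w A (R ∪ S) ≤ idxF p h f w A S by
    simpa [Finset.sdiff_union_of_subset hST] using
      h_union (T \ S) Finset.sdiff_disjoint Finset.sdiff_subset
  intro R
  induction R using Finset.induction_on with
  | empty => simp
  | insert l R hl ih =>
    intro hdisj hRT
    rw [Finset.disjoint_insert_left] at hdisj
    rw [Finset.insert_subset_iff] at hRT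
    have hsub : insert l (R ∪ S) ⊆ T :=
      Finset.insert_subset hRT.1 (Finset.union_subset hRT.2 hST)
    rw [Finset.insert_union]
    exact (idxF_insert_le hp hK hKp hh0 hsm hf (hS.mono Finset.subset_union_right)
      (by simp [hl, hdisj.1]) (fun i hi => hw i (hsub hi)) (fun i hi => hA i (hsub hi))
      (fun i hi => hsA i (hsub hi))).trans (ih hdisj.2 hRT.2)

/-- `F(M_k)` is dominated (in the Loewner order) by each pairwise quantity
`h(wᵢ+w_j) f([(wᵢ Aᵢ^p + w_j A_j^p)/(wᵢ+w_j)]^{1/p}) − h(wᵢ) f(Aᵢ) − h(w_j) f(A_j)`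
for `1 ≤ i < j ≤ k`, where `M_k = {1, …, k}`. -/
theorem stmt10 (p : ℝ) (hp : 0 < p) (K : Set ℝ) (hK : K ⊆ Set.Ici 0) (hKp : PConvex p K)
    (h : ℝ → ℝ) (hh0 : ∀ x : ℝ, 0 < x → 0 ≤ h x)
    (hsm : ∀ x y : ℝ, 0 < x → 0 < y → h x * h y ≤ h (x * y))
    (f : ℝ → ℝ) (hf : OperatorPHConvexOn p K h f)
    (k : ℕ) (hk : 2 ≤ k)
    (n : ℕ) (w : ℕ → ℝ) (A : ℕ → Matrix (Fin n) (Fin n) ℂ)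
    (hw : ∀ i, 1 ≤ i → i ≤ k → 0 < w i)
    (hA : ∀ i, 1 ≤ i → i ≤ k → (A i).PosSemidef)
    (hsA : ∀ i, 1 ≤ i → i ≤ k → spectrum ℝ (A i) ⊆ K) :
    ∀ i j, 1 ≤ i → i < j → j ≤ k →
      loewnerLE (idxF p h f w A (Finset.Icc 1 k))
        (h (w i + w j) •
            cfc f (mpow ((w i + w j)⁻¹ • (w i • mpow (A i) p + w j • mpow (A j) p)) (1 / p))
          - h (w i) • cfc f (A i) - h (w j) • cfc f (A j)) := by
  intro i j hi hij hj
  have hpair : ({i, j} : Finset ℕ) ⊆ Finset.Icc 1 k := by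
    intro x hx
    simp only [Finset.mem_insert, Finset.mem_singleton] at hx
    rw [Finset.mem_Icc]
    omega
  have hle := loewnerLE_idxF_of_subset hp hK hKp hh0 hsm hf (Finset.insert_nonempty i {j}) hpair
    (fun l hl => hw l (Finset.mem_Icc.1 hl).1 (Finset.mem_Icc.1 hl).2)
    (fun l hl => hA l (Finset.mem_Icc.1 hl).1 (Finset.mem_Icc.1 hl).2)
    (fun l hl => hsA l (Finset.mem_Icc.1 hl).1 (Finset.mem_Icc.1 hl).2)
  rw [sub_sub]
  simpa only [idxF, Finset.sum_pair hij.ne] using hle
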